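/- Fix s ≥ 1, t ≥ 1, c > 0, τ > 0, and ε₀ ≥ 0. Let x₁,…,x_s, y₁,…,y_s ∈ ℝ^d and let f : ℝ^d → {0,1}^t be any function. Suppose EMD( (x₁,…,x_s), (y₁,…,y_s) ) ≥ cτ, and that for every i, j ∈ {1,…,s}, ‖f(x_i) − f(y_j)‖₁ ≥ t·( min{ 1/4, ‖x_i − y_j‖₁/(4cτ) } − ε₀ ). Then EMD( (f(x₁),…,f(x_s)), (f(y₁),…,f(y_s)) ) ≥ t·(1/4 − s·ε₀). -/

import Mathlib

open Finset

/-- ℓ₁ distance on `ℝ^d`. -/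
noncomputable def l1dist {d : ℕ} (a b : Fin d → ℝ) : ℝ := ∑ i, |a i - b i|

/-- Earth Mover's distance between `s`-tuples of points of `ℝ^d` with ℓ₁ ground metric. -/
noncomputable def EMDreal {d s : ℕ} (x y : Fin s → Fin d → ℝ) : ℝ :=
  Finset.inf' Finset.univ ⟨Equiv.refl (Fin s), Finset.mem_univ _⟩
    fun σ : Equiv.Perm (Fin s) => ∑ i, l1dist (x i) (y (σ i))

/-- Earth Mover's distance between `s`-tuples of points of the hypercube `{0,1}^t`,
with the Hamming distance as ground metric. -/
noncomputable def EMDbool {t s : ℕ} (x y : Fin s → Fin t → Bool) : ℝ :=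
  Finset.inf' Finset.univ ⟨Equiv.refl (Fin s), Finset.mem_univ _⟩
    fun σ : Equiv.Perm (Fin s) => ∑ i, (hammingDist (x i) (y (σ i)) : ℝ)

/-- deterministic core of the 'far points stay far' direction of the
threshold embedding of `EMD_s(ℝ^d, ℓ₁)` into `EMD_s({0,1}^t)`. -/
theorem stmt_6 (d s t : ℕ) (hs : 1 ≤ s) (ht : 1 ≤ t) (c τ ε₀ : ℝ)
    (hc : 0 < c) (hτ : 0 < τ) (hε : 0 ≤ ε₀)
    (x y : Fin s → Fin d → ℝ) (f : (Fin d → ℝ) → Fin t → Bool)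
    (hfar : c * τ ≤ EMDreal x y)
    (hsep : ∀ i j : Fin s,
      (t : ℝ) * (min (1 / 4) (l1dist (x i) (y j) / (4 * c * τ)) - ε₀) ≤
        (hammingDist (f (x i)) (f (y j)) : ℝ)) :
    (t : ℝ) * (1 / 4 - (s : ℝ) * ε₀) ≤
      EMDbool (fun i => f (x i)) (fun i => f (y i)) := by
  unfold EMDbool
  apply Finset.le_inf'
  intro σ _
  have h1 : c * τ ≤ ∑ i, l1dist (x i) (y (σ i)) :=
    hfar.trans (Finset.inf'_le _ (Finset.mem_univ σ))
  have hpos : 0 < 4 * c * τ := by positivity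
  have hl : ∀ i, 0 ≤ l1dist (x i) (y (σ i)) / (4 * c * τ) := fun i =>
    div_nonneg (Finset.sum_nonneg fun _ _ => abs_nonneg _) hpos.le
  have key : (1 / 4 : ℝ) ≤ ∑ i, min (1 / 4) (l1dist (x i) (y (σ i)) / (4 * c * τ)) := by
    by_cases h : ∃ i, 1 / 4 ≤ l1dist (x i) (y (σ i)) / (4 * c * τ)
    · obtain ⟨i, hi⟩ := h
      have h2 := Finset.single_le_sum
        (f := fun i => min (1 / 4 : ℝ) (l1dist (x i) (y (σ i)) / (4 * c * τ)))
        (fun j _ => le_min (by norm_num) (hl j)) (Finset.mem_univ i)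
      simp only [min_eq_left hi] at h2
      exact h2
    · push Not at h
      rw [Finset.sum_congr rfl fun i _ => min_eq_right (h i).le, ← Finset.sum_div,
        le_div_iff₀ hpos]
      linarith
  calc (t : ℝ) * (1 / 4 - (s : ℝ) * ε₀)
      ≤ t * (∑ i, min (1 / 4) (l1dist (x i) (y (σ i)) / (4 * c * τ)) - s * ε₀) := by gcongr
    _ = ∑ i, (t : ℝ) * (min (1 / 4) (l1dist (x i) (y (σ i)) / (4 * c * τ)) - ε₀) := by
        rw [← Finset.mul_sum, Finset.sum_sub_distrib]; simp
    _ ≤ _ := Finset.sum_le_sum fun i _ => hsep i (σ i)
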